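/- Homotopy invariance: let F ∈ ℂ[T,Z] be a polynomial in two variables and Γ ⊂ ℂ a rectangle such that for each t ∈ [0,1] the one-variable polynomial F_t := F(t, Z) ∈ ℂ[Z] has no root on the boundary ∂Γ. Then ind_{∂Γ}(F_0) = ind_{∂Γ}(F_1). -/

import Mathlib

open Polynomial

/-- The value at `x` of the "unit part" of `P` after removing the factor `(X - x)^m`,
where `m` is the multiplicity of `x` as a root of `P`. Nonzero whenever `P ≠ 0`. -/
noncomputable def unitEval (P : Polynomial ℝ) (x : ℝ) : ℝ :=
  (P /ₘ (X - C x) ^ rootMultiplicity x P).eval x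

/-- One-sided Cauchy index `Ind_x^+` of the rational function `R/S` at `x`. -/
noncomputable def indPlus (R S : Polynomial ℝ) (x : ℝ) : ℝ :=
  if (rootMultiplicity x R : ℤ) < (rootMultiplicity x S : ℤ) then
    (1 / 2) * Real.sign (unitEval R x * unitEval S x)
  else 0

/-- One-sided Cauchy index `Ind_x^-` of the rational function `R/S` at `x`. -/
noncomputable def indMinus (R S : Polynomial ℝ) (x : ℝ) : ℝ :=
  if (rootMultiplicity x R : ℤ) < (rootMultiplicity x S : ℤ) then
    (1 / 2) * (-1 : ℝ) ^ (rootMultiplicity x S - rootMultiplicity x R) *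
      Real.sign (unitEval R x * unitEval S x)
  else 0

/-- Local Cauchy index `Ind_x(R/S) = Ind_x^+(R/S) - Ind_x^-(R/S)`. -/
noncomputable def indPoint (R S : Polynomial ℝ) (x : ℝ) : ℝ :=
  indPlus R S x - indMinus R S x

/-- The Cauchy index `Ind_a^b(R/S)` of the rational function `R/S` on `[a, b]`:
`Ind_a^+(R/S) + Σ_{x ∈ (a,b)} Ind_x(R/S) - Ind_b^-(R/S)`, with the convention that
it is `0` when `R = 0` or `S = 0`.  (Only poles, i.e. roots of `S`, contribute to
the middle sum.) -/
noncomputable def cauchyIndex (R S : Polynomial ℝ) (a b : ℝ) : ℝ :=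
  if R = 0 ∨ S = 0 then 0
  else indPlus R S a +
      (∑ x ∈ S.roots.toFinset, if a < x ∧ x < b then indPoint R S x else 0) -
      indMinus R S b

/-- Number of sign changes `V(s_0, …, s_n) = Σ ½|sign s_{k-1} - sign s_k|` of a list of reals. -/
noncomputable def signVar : List ℝ → ℝ
  | [] => 0
  | [_] => 0
  | a :: b :: l => (1 / 2) * |Real.sign a - Real.sign b| + signVar (b :: l)

/-- Sign changes `V_x(S_0, …, S_n)` of a list of real polynomials evaluated at `x`. -/
noncomputable def signVarAt (L : List (Polynomial ℝ)) (x : ℝ) : ℝ :=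
  signVar (L.map fun P => P.eval x)

/-- Real part of a complex polynomial, coefficientwise. -/
noncomputable def rePoly (p : Polynomial ℂ) : Polynomial ℝ :=
  p.sum fun n c => Polynomial.C c.re * Polynomial.X ^ n

/-- Imaginary part of a complex polynomial, coefficientwise. -/
noncomputable def imPoly (p : Polynomial ℂ) : Polynomial ℝ :=
  p.sum fun n c => Polynomial.C c.im * Polynomial.X ^ n

/-- For `F ∈ ℂ[Z]`, the one-variable polynomial `F̂(t) = F(a + t(b - a))` obtained by
substituting the affine parametrization of the segment from `a` to `b` (this is the
substitution `Z = X + iY` followed by the parametrization of the segment). -/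
noncomputable def segPolyC (F : Polynomial ℂ) (a b : ℂ) : Polynomial ℂ :=
  F.comp (Polynomial.C a + Polynomial.C (b - a) * Polynomial.X)

/-- The index `ind_{[a,b]}(F) = ½ · Ind_0^1(re F̂ / im F̂)` of `F ∈ ℂ[Z]` along the
segment from `a` to `b`. -/
noncomputable def segIndexC (F : Polynomial ℂ) (a b : ℂ) : ℝ :=
  (1 / 2) * cauchyIndex (rePoly (segPolyC F a b)) (imPoly (segPolyC F a b)) 0 1

/-- The algebraic index `ind_{∂Γ}(F)` of `F ∈ ℂ[Z]` along the positively oriented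
boundary of the rectangle `Γ = [x₀,x₁] × [y₀,y₁] ⊂ ℂ` with vertices
`a = x₀ + iy₀`, `b = x₁ + iy₀`, `c = x₁ + iy₁`, `d = x₀ + iy₁`. -/
noncomputable def rectIndexC (F : Polynomial ℂ) (x₀ x₁ y₀ y₁ : ℝ) : ℝ :=
  segIndexC F (x₀ + y₀ * Complex.I) (x₁ + y₀ * Complex.I) +
  segIndexC F (x₁ + y₀ * Complex.I) (x₁ + y₁ * Complex.I) +
  segIndexC F (x₁ + y₁ * Complex.I) (x₀ + y₁ * Complex.I) +
  segIndexC F (x₀ + y₁ * Complex.I) (x₀ + y₀ * Complex.I)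

open Filter Topology

theorem Real.sign_mul_of_pos {u : ℝ} (hu : 0 < u) (v : ℝ) : Real.sign (u * v) = Real.sign v := by
  rcases lt_trichotomy v 0 with h | rfl | h
  · rw [Real.sign_of_neg h, Real.sign_of_neg (mul_neg_of_pos_of_neg hu h)]
  · simp
  · rw [Real.sign_of_pos h, Real.sign_of_pos (mul_pos hu h)]

theorem Real.eventually_sign_eq {f : ℝ → ℝ} {b : ℝ} (hf : ContinuousAt f b) (hb : f b ≠ 0) :
    ∀ᶠ x in 𝓝 b, Real.sign (f x) = Real.sign (f b) := by
  rcases lt_or_gt_of_ne hb with h | h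
  · filter_upwards [hf.eventually (eventually_lt_nhds h)] with x hx
    rw [Real.sign_of_neg h, Real.sign_of_neg hx]
  · filter_upwards [hf.eventually (eventually_gt_nhds h)] with x hx
    rw [Real.sign_of_pos h, Real.sign_of_pos hx]

/-- The half-integer step function of the angle that increases by `1` every time the angle
crosses a multiple of `π`. -/
noncomputable def angleStep (θ : ℝ) : ℝ := ((⌊θ / Real.pi⌋ : ℝ) + ⌈θ / Real.pi⌉) / 2

theorem angleStep_add_int_mul_two_pi (θ : ℝ) (k : ℤ) :
    angleStep (θ + k * (2 * Real.pi)) = angleStep θ + 2 * k := by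
  have h : (θ + k * (2 * Real.pi)) / Real.pi = θ / Real.pi + ((2 * k : ℤ) : ℝ) := by
    push_cast
    field_simp [Real.pi_ne_zero]
  rw [angleStep, angleStep, h, Int.floor_add_intCast, Int.ceil_add_intCast]
  push_cast
  ring

theorem angleStep_int_mul_pi_add (k : ℤ) {δ : ℝ} (hδ : |δ| < Real.pi) :
    angleStep (k * Real.pi + δ) = k + 1 / 2 * Real.sign (Real.sin δ) := by
  have hπ := Real.pi_pos
  obtain ⟨h1, h2⟩ := abs_lt.1 hδ
  have h : (k * Real.pi + δ) / Real.pi = δ / Real.pi + (k : ℤ) := by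
    field_simp
    ring
  rw [angleStep, h, Int.floor_add_intCast, Int.ceil_add_intCast]
  rcases lt_trichotomy δ 0 with h | rfl | h
  · have hf : ⌊δ / Real.pi⌋ = -1 := by
      rw [Int.floor_eq_iff]
      constructor
      · push_cast; rw [le_div_iff₀ hπ]; linarith
      · push_cast; rw [div_lt_iff₀ hπ]; linarith
    have hc : ⌈δ / Real.pi⌉ = 0 := by
      rw [Int.ceil_eq_iff]
      constructor
      · push_cast; rw [lt_div_iff₀ hπ]; linarith
      · push_cast; rw [div_le_iff₀ hπ]; linarith
    rw [hf, hc, Real.sign_of_neg (Real.sin_neg_of_neg_of_neg_pi_lt h h1)]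
    push_cast
    ring
  · simp
  · have hf : ⌊δ / Real.pi⌋ = 0 := by
      rw [Int.floor_eq_iff]
      constructor
      · push_cast; rw [le_div_iff₀ hπ]; linarith
      · push_cast; rw [div_lt_iff₀ hπ]; linarith
    have hc : ⌈δ / Real.pi⌉ = 1 := by
      rw [Int.ceil_eq_iff]
      constructor
      · push_cast; rw [lt_div_iff₀ hπ]; linarith
      · push_cast; rw [div_le_iff₀ hπ]; linarith
    rw [hf, hc, Real.sign_of_pos (Real.sin_pos_of_pos_of_lt_pi h h2)]
    push_cast
    ring

theorem eventually_angleStep_of_sin_eq_zero {θ₀ : ℝ} (h : Real.sin θ₀ = 0) :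
    ∀ᶠ θ in 𝓝 θ₀,
      angleStep θ - angleStep θ₀ = 1 / 2 * Real.sign (Real.cos θ * Real.sin θ) := by
  have hπ := Real.pi_pos
  obtain ⟨n, rfl⟩ := Real.sin_eq_zero_iff.1 h
  filter_upwards [Metric.ball_mem_nhds (n * Real.pi) (half_pos hπ)] with θ hθ
  rw [Metric.mem_ball, Real.dist_eq] at hθ
  obtain ⟨δ, rfl⟩ : ∃ δ, θ = n * Real.pi + δ := ⟨θ - n * Real.pi, by ring⟩
  rw [add_sub_cancel_left] at hθ
  have hcos : 0 < Real.cos δ := Real.cos_pos_of_mem_Ioo (abs_lt.1 hθ)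
  have h0 := angleStep_int_mul_pi_add n (δ := 0) (by simpa using hπ)
  rw [add_zero] at h0
  have hprod : Real.cos (n * Real.pi + δ) * Real.sin (n * Real.pi + δ)
      = Real.cos δ * Real.sin δ := by
    have hc : Real.cos (n * Real.pi) ^ 2 = 1 := by
      have := Real.sin_sq_add_cos_sq (n * Real.pi)
      rw [h] at this
      linarith
    rw [Real.cos_add, Real.sin_add, h]
    linear_combination (Real.cos δ * Real.sin δ) * hc
  rw [h0, angleStep_int_mul_pi_add n (hθ.trans (half_lt_self hπ)), hprod,
    Real.sign_mul_of_pos hcos]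
  simp

theorem eventually_angleStep_of_sin_ne_zero {θ₀ : ℝ} (h : Real.sin θ₀ ≠ 0) :
    ∀ᶠ θ in 𝓝 θ₀, angleStep θ = angleStep θ₀ := by
  have hπ := Real.pi_pos
  have key : ∀ θ : ℝ, (⌊θ₀ / Real.pi⌋ : ℝ) * Real.pi < θ →
      θ < (⌊θ₀ / Real.pi⌋ + 1) * Real.pi → angleStep θ = ⌊θ₀ / Real.pi⌋ + 1 / 2 := by
    intro θ h1 h2
    have h3 : 0 < θ - ⌊θ₀ / Real.pi⌋ * Real.pi := by linarith
    have h4 : θ - ⌊θ₀ / Real.pi⌋ * Real.pi < Real.pi := by linarith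
    have := angleStep_int_mul_pi_add ⌊θ₀ / Real.pi⌋ (δ := θ - ⌊θ₀ / Real.pi⌋ * Real.pi)
      (by rwa [abs_of_pos h3])
    rw [add_sub_cancel, Real.sign_of_pos (Real.sin_pos_of_pos_of_lt_pi h3 h4), mul_one] at this
    exact this
  have h1 : (⌊θ₀ / Real.pi⌋ : ℝ) * Real.pi < θ₀ := by
    refine lt_of_le_of_ne ((le_div_iff₀ hπ).1 (Int.floor_le _)) fun he => h ?_
    rw [← he, Real.sin_int_mul_pi]
  have h2 : θ₀ < (⌊θ₀ / Real.pi⌋ + 1) * Real.pi :=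
    (div_lt_iff₀ hπ).1 (Int.lt_floor_add_one _)
  filter_upwards [eventually_gt_nhds h1, eventually_lt_nhds h2] with θ hθ1 hθ2
  rw [key θ hθ1 hθ2, key θ₀ h1 h2]

theorem unitEval_of_eval_ne_zero {P : Polynomial ℝ} {x : ℝ} (h : P.eval x ≠ 0) :
    unitEval P x = P.eval x := by
  simp [unitEval, rootMultiplicity_eq_zero (p := P) (x := x) h]

theorem indPlus_of_eval_ne_zero (R : Polynomial ℝ) {S : Polynomial ℝ} {x : ℝ}
    (h : S.eval x ≠ 0) : indPlus R S x = 0 := by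
  simp [indPlus, rootMultiplicity_eq_zero (p := S) (x := x) h]

theorem indMinus_of_eval_ne_zero (R : Polynomial ℝ) {S : Polynomial ℝ} {x : ℝ}
    (h : S.eval x ≠ 0) : indMinus R S x = 0 := by
  simp [indMinus, rootMultiplicity_eq_zero (p := S) (x := x) h]

theorem eventually_ind_eq_sign {R S : Polynomial ℝ} {b : ℝ} (hS : S ≠ 0)
    (hSb : S.eval b = 0) (hRb : R.eval b ≠ 0) :
    ∀ᶠ x in 𝓝 b,
      (b < x → indPlus R S b = 1 / 2 * Real.sign (R.eval x * S.eval x)) ∧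
      (x < b → indMinus R S b = 1 / 2 * Real.sign (R.eval x * S.eval x)) := by
  have hn : 0 < rootMultiplicity b S := (rootMultiplicity_pos hS).2 hSb
  have hm : rootMultiplicity b R = 0 := rootMultiplicity_eq_zero hRb
  set n := rootMultiplicity b S with hn_def
  set S₁ := S /ₘ (X - C b) ^ n with hS₁
  have hS₁b : S₁.eval b ≠ 0 := eval_divByMonic_pow_rootMultiplicity_ne_zero b hS
  have hfac : ∀ x, S.eval x = (x - b) ^ n * S₁.eval x := by
    intro x
    conv_lhs => rw [← pow_mul_divByMonic_rootMultiplicity_eq S b]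
    simp [hS₁, hn_def]
  have hlt : (rootMultiplicity b R : ℤ) < (rootMultiplicity b S : ℤ) := by
    rw [hm]; exact_mod_cast hn
  have hu : unitEval S b = S₁.eval b := rfl
  filter_upwards [Real.eventually_sign_eq (f := fun x => R.eval x * S₁.eval x) (b := b)
    (by fun_prop) (mul_ne_zero hRb hS₁b)] with x hx
  constructor
  · intro hbx
    rw [indPlus, if_pos hlt, unitEval_of_eval_ne_zero hRb, hu, hfac, mul_left_comm,
      Real.sign_mul_of_pos (pow_pos (sub_pos.2 hbx) n), hx]
  · intro hxb
    have h : R.eval x * ((x - b) ^ n * S₁.eval x)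
        = (b - x) ^ n * ((-1) ^ n * (R.eval x * S₁.eval x)) := by
      rw [← neg_sub b x, neg_pow]; ring
    rw [indMinus, if_pos hlt, unitEval_of_eval_ne_zero hRb, hu, hfac, h,
      Real.sign_mul_of_pos (pow_pos (sub_pos.2 hxb) n), hm, Nat.sub_zero, ← hn_def, ← hx]
    rcases neg_one_pow_eq_or ℝ n with h | h <;> simp [h, Real.sign_neg]

theorem eq_of_eventually_eq_on_Icc {f : ℝ → ℝ}
    (h : ∀ b ∈ Set.Icc (0 : ℝ) 1, ∀ᶠ x in 𝓝 b, x ∈ Set.Icc (0 : ℝ) 1 → f x = f b) :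
    f 0 = f 1 := by
  have hl : IsLocallyConstant (fun x : Set.Icc (0 : ℝ) 1 => f x) := by
    rw [IsLocallyConstant.iff_eventually_eq]
    intro b
    filter_upwards [continuous_subtype_val.continuousAt.eventually (h b b.2)] with x hx
    exact hx x.2
  exact hl.apply_eq_of_preconnectedSpace ⟨0, by simp⟩ ⟨1, by simp⟩

/-- The sum of the right jumps `p` in `[0, b)` minus the sum of the left jumps `m` in `(0, b]`. -/
noncomputable def jumpSum (A : Finset ℝ) (p m : ℝ → ℝ) (b : ℝ) : ℝ :=
  ∑ x ∈ A, ((if 0 ≤ x ∧ x < b then p x else 0) - (if 0 < x ∧ x ≤ b then m x else 0))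

theorem eventually_jumpSum_sub {A : Finset ℝ} {p m : ℝ → ℝ} (hp : ∀ x, x ∉ A → p x = 0)
    (hm : ∀ x, x ∉ A → m x = 0) {b : ℝ} (hb : 0 ≤ b) :
    ∀ᶠ y in 𝓝 b, 0 ≤ y →
      (b < y → jumpSum A p m y - jumpSum A p m b = p b) ∧
      (y < b → jumpSum A p m y - jumpSum A p m b = m b) := by
  have hA : ∀ᶠ y in 𝓝 b, ∀ x ∈ A, x ≠ b → (x < y ↔ x < b) ∧ (x ≤ y ↔ x ≤ b) := by
    rw [Filter.eventually_all_finset]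
    intro x _
    rcases lt_trichotomy x b with h | h | h
    · filter_upwards [eventually_gt_nhds h] with y hy _
      exact ⟨iff_of_true hy h, iff_of_true hy.le h.le⟩
    · exact Eventually.of_forall fun y hne => absurd h hne
    · filter_upwards [eventually_lt_nhds h] with y hy _
      exact ⟨iff_of_false hy.not_gt h.not_gt, iff_of_false hy.not_ge h.not_ge⟩
  filter_upwards [hA] with y hy hy0
  have hsum : ∀ q : ℝ → ℝ, (∀ x, x ∉ A → q x = 0) →
      ∑ x ∈ A, (if x = b then q x else 0) = q b := by
    intro q hq
    rw [Finset.sum_ite_eq']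
    split_ifs with h
    · rfl
    · exact (hq b h).symm
  constructor
  · intro hby
    rw [jumpSum, jumpSum, ← Finset.sum_sub_distrib, ← hsum p hp]
    refine Finset.sum_congr rfl fun x hx => ?_
    by_cases hxb : x = b
    · subst hxb
      simp [hb, hby, hby.le]
    · simp [(hy x hx hxb).1, (hy x hx hxb).2, hxb]
  · intro hyb
    rw [jumpSum, jumpSum, ← Finset.sum_sub_distrib, ← hsum m hm]
    refine Finset.sum_congr rfl fun x hx => ?_
    by_cases hxb : x = b
    · subst hxb
      simp [hyb.not_gt, hyb.not_ge, hy0.trans_lt hyb]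
    · simp [(hy x hx hxb).1, (hy x hx hxb).2, hxb]

theorem jumpSum_roots_eq_cauchyIndex {R S : Polynomial ℝ} (hR : R ≠ 0) (hS : S ≠ 0) :
    jumpSum S.roots.toFinset (indPlus R S) (indMinus R S) 1 = cauchyIndex R S 0 1 := by
  have hmem : ∀ x, x ∉ S.roots.toFinset → S.eval x ≠ 0 := by
    intro x hx h
    exact hx (by simpa [hS] using h)
  have h0 : indPlus R S 0 = ∑ x ∈ S.roots.toFinset, if x = 0 then indPlus R S x else 0 := by
    rw [Finset.sum_ite_eq']
    split_ifs with h
    · rfl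
    · exact indPlus_of_eval_ne_zero R (hmem 0 h)
  have h1 : indMinus R S 1 = ∑ x ∈ S.roots.toFinset, if x = 1 then indMinus R S x else 0 := by
    rw [Finset.sum_ite_eq']
    split_ifs with h
    · rfl
    · exact indMinus_of_eval_ne_zero R (hmem 1 h)
  rw [cauchyIndex, if_neg (by tauto), h0, h1, ← Finset.sum_add_distrib, ← Finset.sum_sub_distrib,
    jumpSum]
  refine Finset.sum_congr rfl fun x _ => ?_
  rw [indPoint]
  rcases lt_trichotomy x 0 with h | rfl | h
  · have h2 : x < 1 := by linarith
    simp [h.not_ge, h.not_gt, h.ne, h2.ne]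
  · simp
  · rcases lt_trichotomy x 1 with h' | rfl | h'
    · simp [h, h.le, h', h'.le, h.ne', h'.ne]
    · simp
    · simp [h'.not_gt, h'.not_ge, h.ne', h'.ne']

/-- The Cauchy index of `R / S` is the variation of `angleStep` along a continuous argument of
`R + i S`. -/
theorem cauchyIndex_eq_angleStep_sub {R S : Polynomial ℝ} {θ ρ : ℝ → ℝ} (hθ : Continuous θ)
    (hρ : ∀ s, 0 < ρ s)
    (hR : ∀ s ∈ Set.Icc (0 : ℝ) 1, R.eval s = ρ s * Real.cos (θ s))
    (hS : ∀ s ∈ Set.Icc (0 : ℝ) 1, S.eval s = ρ s * Real.sin (θ s)) :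
    cauchyIndex R S 0 1 = angleStep (θ 1) - angleStep (θ 0) := by
  have hsin : ∀ s ∈ Set.Icc (0 : ℝ) 1, (Real.sin (θ s) = 0 ↔ S.eval s = 0) := by
    intro s hs
    simp [hS s hs, (hρ s).ne']
  have hsign : ∀ s ∈ Set.Icc (0 : ℝ) 1,
      Real.sign (Real.cos (θ s) * Real.sin (θ s)) = Real.sign (R.eval s * S.eval s) := by
    intro s hs
    rw [hR s hs, hS s hs, mul_mul_mul_comm, Real.sign_mul_of_pos (mul_pos (hρ s) (hρ s))]
  have hne : ∀ s ∈ Set.Icc (0 : ℝ) 1, S.eval s = 0 → R.eval s ≠ 0 := by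
    intro s hs h0 h1
    rw [hR s hs, mul_eq_zero, or_iff_right (hρ s).ne'] at h1
    have := Real.sin_sq_add_cos_sq (θ s)
    rw [(hsin s hs).2 h0, h1] at this
    norm_num at this
  by_cases hdeg : R = 0 ∨ S = 0
  · rw [cauchyIndex, if_pos hdeg, eq_comm, sub_eq_zero]
    symm
    refine eq_of_eventually_eq_on_Icc (f := fun s => angleStep (θ s)) fun b hb => ?_
    by_cases hSb : S.eval b = 0
    · filter_upwards [hθ.continuousAt.eventually
        (eventually_angleStep_of_sin_eq_zero ((hsin b hb).2 hSb))] with x hx hx01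
      rw [hsign x hx01] at hx
      have h0 : R.eval x * S.eval x = 0 := by rcases hdeg with rfl | rfl <;> simp
      rw [h0, Real.sign_zero, mul_zero] at hx
      exact sub_eq_zero.1 hx
    · filter_upwards [hθ.continuousAt.eventually
        (eventually_angleStep_of_sin_ne_zero (mt (hsin b hb).1 hSb))] with x hx _
      exact hx
  · obtain ⟨hR0, hS0⟩ := not_or.1 hdeg
    have hmem : ∀ x, x ∉ S.roots.toFinset → S.eval x ≠ 0 := by
      intro x hx h
      exact hx (by simpa [hS0] using h)
    set J := jumpSum S.roots.toFinset (indPlus R S) (indMinus R S) with hJ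
    have hJ0 : J 0 = 0 := by
      refine Finset.sum_eq_zero fun x _ => ?_
      rw [if_neg (by rintro ⟨h1, h2⟩; linarith), if_neg (by rintro ⟨h1, h2⟩; linarith), sub_self]
    have key : J 0 - angleStep (θ 0) = J 1 - angleStep (θ 1) := by
      refine eq_of_eventually_eq_on_Icc (f := fun s => J s - angleStep (θ s)) fun b hb => ?_
      have hjump := eventually_jumpSum_sub (p := indPlus R S) (m := indMinus R S)
        (fun x hx => indPlus_of_eval_ne_zero R (hmem x hx))
        (fun x hx => indMinus_of_eval_ne_zero R (hmem x hx)) hb.1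
      by_cases hSb : S.eval b = 0
      · filter_upwards [hjump, eventually_ind_eq_sign hS0 hSb (hne b hb hSb),
          hθ.continuousAt.eventually (eventually_angleStep_of_sin_eq_zero ((hsin b hb).2 hSb))]
          with x hx1 hx2 hx3 hx01
        rw [hsign x hx01] at hx3
        rcases lt_trichotomy b x with h | rfl | h
        · have h1 := (hx1 hx01.1).1 h
          have h2 := hx2.1 h
          linarith
        · rfl
        · have h1 := (hx1 hx01.1).2 h
          have h2 := hx2.2 h
          linarith
      · filter_upwards [hjump, hθ.continuousAt.eventually
          (eventually_angleStep_of_sin_ne_zero (mt (hsin b hb).1 hSb))] with x hx1 hx3 hx01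
        rw [indPlus_of_eval_ne_zero R hSb, indMinus_of_eval_ne_zero R hSb] at hx1
        rcases lt_trichotomy b x with h | rfl | h
        · have h1 := (hx1 hx01.1).1 h
          linarith
        · rfl
        · have h1 := (hx1 hx01.1).2 h
          linarith
    rw [← jumpSum_roots_eq_cauchyIndex hR0 hS0]
    linarith

theorem eval_rePoly (p : Polynomial ℂ) (x : ℝ) : (rePoly p).eval x = (p.eval (x : ℂ)).re := by
  rw [rePoly, Polynomial.sum_def, eval_finsetSum, eval_eq_sum, Polynomial.sum_def, Complex.re_sum]
  refine Finset.sum_congr rfl fun n _ => ?_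
  rw [← Complex.ofReal_pow]
  simp [-Complex.ofReal_pow]

theorem eval_imPoly (p : Polynomial ℂ) (x : ℝ) : (imPoly p).eval x = (p.eval (x : ℂ)).im := by
  rw [imPoly, Polynomial.sum_def, eval_finsetSum, eval_eq_sum, Polynomial.sum_def, Complex.im_sum]
  refine Finset.sum_congr rfl fun n _ => ?_
  rw [← Complex.ofReal_pow]
  simp [-Complex.ofReal_pow]

theorem eval_segPolyC (F : Polynomial ℂ) (a b z : ℂ) :
    (segPolyC F a b).eval z = F.eval (a + (b - a) * z) := by
  simp [segPolyC]

theorem segIndexC_eq_angleStep_sub {F : Polynomial ℂ} {a b : ℂ} {L : ℝ → ℂ} (hL : Continuous L)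
    (h : ∀ s ∈ Set.Icc (0 : ℝ) 1, Complex.exp (L s) = F.eval (a + (b - a) * s)) :
    segIndexC F a b = 1 / 2 * (angleStep (L 1).im - angleStep (L 0).im) := by
  rw [segIndexC, cauchyIndex_eq_angleStep_sub (θ := fun s => (L s).im)
    (ρ := fun s => Real.exp (L s).re) (by fun_prop) (fun s => Real.exp_pos _)]
  · intro s hs
    rw [eval_rePoly, eval_segPolyC, ← h s hs, Complex.exp_re]
  · intro s hs
    rw [eval_imPoly, eval_segPolyC, ← h s hs, Complex.exp_im]

theorem exists_continuous_log {g : ℝ × ℝ → ℂ} (hg : Continuous g) (h0 : ∀ x, g x ≠ 0) :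
    ∃ L : ℝ × ℝ → ℂ, Continuous L ∧ ∀ x, Complex.exp (L x) = g x := by
  have hU : IsSimplyConnected (Set.univ : Set (ℝ × ℝ)) := by
    have := (convex_univ (𝕜 := ℝ) (E := ℝ × ℝ)).contractibleSpace Set.univ_nonempty
    exact SimplyConnectedSpace.ofContractible _
  obtain ⟨L, hL, hexp⟩ := Complex.exists_continuousOn_eqOn_exp_comp hU isOpen_univ
    hg.continuousOn (by rintro ⟨x, _, hx⟩; exact h0 x hx)
  exact ⟨L, continuousOn_univ.1 hL, fun x => hexp (Set.mem_univ x)⟩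

theorem continuous_eval_eval_C (F : Polynomial (Polynomial ℂ)) :
    Continuous fun x : ℂ × ℂ => (F.eval (C x.1)).eval x.2 := by
  simp only [Polynomial.eval_eq_sum_range (p := F), eval_finsetSum, eval_mul, eval_pow, eval_C]
  refine continuous_finsetSum _ fun i _ => ?_
  exact ((F.coeff i).continuous.comp continuous_snd).mul (continuous_fst.pow i)

/-- A homotopy of nonvanishing values along a segment has a continuous logarithm. -/
theorem exists_log_along_segment (F : Polynomial (Polynomial ℂ)) (a b : ℂ)
    (h : ∀ t ∈ Set.Icc (0 : ℝ) 1, ∀ s ∈ Set.Icc (0 : ℝ) 1,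
      (F.eval (C (t : ℂ))).eval (a + (b - a) * s) ≠ 0) :
    ∃ L : ℝ × ℝ → ℂ, Continuous L ∧ ∀ t ∈ Set.Icc (0 : ℝ) 1, ∀ s ∈ Set.Icc (0 : ℝ) 1,
      Complex.exp (L (t, s)) = (F.eval (C (t : ℂ))).eval (a + (b - a) * s) := by
  let c : ℝ → ℝ := fun t => Set.projIcc (0 : ℝ) 1 zero_le_one t
  have hc : Continuous c := continuous_subtype_val.comp continuous_projIcc
  have hmem : ∀ t, c t ∈ Set.Icc (0 : ℝ) 1 := fun t => (Set.projIcc (0 : ℝ) 1 zero_le_one t).2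
  have hid : ∀ t ∈ Set.Icc (0 : ℝ) 1, c t = t := fun t ht => by
    simp only [c, Set.projIcc_of_mem zero_le_one ht]
  obtain ⟨L, hL, hexp⟩ := exists_continuous_log
    (g := fun x => (F.eval (C (c x.1 : ℂ))).eval (a + (b - a) * (c x.2 : ℂ)))
    ((continuous_eval_eval_C F).comp (f := fun x : ℝ × ℝ =>
      ((c x.1 : ℂ), a + (b - a) * (c x.2 : ℂ))) (by fun_prop))
    (fun x => h _ (hmem _) _ (hmem _))
  refine ⟨L, hL, fun t ht s hs => ?_⟩
  rw [hexp]
  simp only [hid t ht, hid s hs]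

/-- Two continuous logarithms of the same function on `[0, 1]` differ by a constant multiple of
`2πi`, so their `angleStep`s differ by a constant. -/
theorem angleStep_sub_eq_of_exp_eq {L M : ℝ → ℂ} (hL : Continuous L) (hM : Continuous M)
    (h : ∀ t ∈ Set.Icc (0 : ℝ) 1, Complex.exp (L t) = Complex.exp (M t)) :
    angleStep (L 0).im - angleStep (M 0).im = angleStep (L 1).im - angleStep (M 1).im := by
  have hπ := Real.two_pi_pos
  have hk : ∀ t ∈ Set.Icc (0 : ℝ) 1, ∃ k : ℤ, (L t).im = (M t).im + k * (2 * Real.pi) := by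
    intro t ht
    obtain ⟨n, hn⟩ := Complex.exp_eq_exp_iff_exists_int.1 (h t ht)
    exact ⟨n, by rw [hn]; simp⟩
  refine eq_of_eventually_eq_on_Icc
    (f := fun t => angleStep (L t).im - angleStep (M t).im) fun b hb => ?_
  have hcont : Continuous fun t => (L t).im - (M t).im := by fun_prop
  filter_upwards [hcont.continuousAt.eventually (Metric.ball_mem_nhds _ hπ)] with t ht ht01
  obtain ⟨k, hk1⟩ := hk t ht01
  obtain ⟨l, hl⟩ := hk b hb
  have hkl : k = l := by
    rw [Real.dist_eq, hk1, hl, add_sub_cancel_left, add_sub_cancel_left,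
      ← sub_mul, abs_mul, abs_of_pos hπ, mul_lt_iff_lt_one_left hπ] at ht
    have : |k - l| < 1 := by exact_mod_cast ht
    have := Int.abs_lt_one_iff.1 this
    omega
  rw [hk1, hl, angleStep_add_int_mul_two_pi, angleStep_add_int_mul_two_pi, hkl]
  ring

/-- Homotopy invariance: let `F ∈ ℂ[T,Z]` (a polynomial in `T` with coefficients in
`ℂ[Z]`), and for `t ∈ [0,1]` write `F_t := F(t, Z) ∈ ℂ[Z]`.  If for each `t ∈ [0,1]`
the polynomial `F_t` has no root on the boundary `∂Γ` of the rectangle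
`Γ = [x₀,x₁] × [y₀,y₁]`, then `ind_{∂Γ}(F_0) = ind_{∂Γ}(F_1)`. -/
theorem rectIndex_homotopy_invariance (F : Polynomial (Polynomial ℂ))
    (x₀ x₁ y₀ y₁ : ℝ) (hx : x₀ < x₁) (hy : y₀ < y₁)
    (hbd : ∀ t ∈ Set.Icc (0 : ℝ) 1, ∀ x ∈ Set.Icc x₀ x₁, ∀ y ∈ Set.Icc y₀ y₁,
      (x = x₀ ∨ x = x₁ ∨ y = y₀ ∨ y = y₁) →
      (F.eval (Polynomial.C (t : ℂ))).eval (x + y * Complex.I) ≠ 0) :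
    rectIndexC (F.eval (Polynomial.C ((0 : ℝ) : ℂ))) x₀ x₁ y₀ y₁ =
      rectIndexC (F.eval (Polynomial.C ((1 : ℝ) : ℂ))) x₀ x₁ y₀ y₁ := by
  have key : ∀ a b : ℂ, (∀ s ∈ Set.Icc (0 : ℝ) 1, ∃ x ∈ Set.Icc x₀ x₁, ∃ y ∈ Set.Icc y₀ y₁,
      (x = x₀ ∨ x = x₁ ∨ y = y₀ ∨ y = y₁) ∧ a + (b - a) * (s : ℂ) = x + y * Complex.I) →
      ∃ L : ℝ × ℝ → ℂ, Continuous L ∧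
        (∀ t ∈ Set.Icc (0 : ℝ) 1, Complex.exp (L (t, 0)) = (F.eval (C (t : ℂ))).eval a) ∧
        (∀ t ∈ Set.Icc (0 : ℝ) 1, Complex.exp (L (t, 1)) = (F.eval (C (t : ℂ))).eval b) ∧
        ∀ t ∈ Set.Icc (0 : ℝ) 1, segIndexC (F.eval (C (t : ℂ))) a b =
          1 / 2 * (angleStep (L (t, 1)).im - angleStep (L (t, 0)).im) := by
    intro a b hab
    obtain ⟨L, hL, hexp⟩ := exists_log_along_segment F a b fun t ht s hs => by
      obtain ⟨x, hx, y, hy, hxy, he⟩ := hab s hs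
      rw [he]
      exact hbd t ht x hx y hy hxy
    refine ⟨L, hL, fun t ht => ?_, fun t ht => ?_, fun t ht => ?_⟩
    · simpa using hexp t ht 0 (by simp)
    · simpa using hexp t ht 1 (by simp)
    · exact segIndexC_eq_angleStep_sub (L := fun s => L (t, s)) (by fun_prop) (hexp t ht)
  have mem_lin : ∀ {u v s : ℝ}, u ≤ v → s ∈ Set.Icc (0 : ℝ) 1 →
      u + (v - u) * s ∈ Set.Icc u v := fun {u v s} huv hs =>
    ⟨by nlinarith [hs.1], by nlinarith [hs.2]⟩
  have mem_lin' : ∀ {u v s : ℝ}, u ≤ v → s ∈ Set.Icc (0 : ℝ) 1 →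
      v + (u - v) * s ∈ Set.Icc u v := fun {u v s} huv hs =>
    ⟨by nlinarith [hs.2], by nlinarith [hs.1]⟩
  obtain ⟨L₁, hL₁, hs₁, he₁, hi₁⟩ := key (x₀ + y₀ * Complex.I) (x₁ + y₀ * Complex.I)
    fun s hs => ⟨_, mem_lin hx.le hs, y₀, ⟨le_rfl, hy.le⟩, by simp, by push_cast; ring⟩
  obtain ⟨L₂, hL₂, hs₂, he₂, hi₂⟩ := key (x₁ + y₀ * Complex.I) (x₁ + y₁ * Complex.I)
    fun s hs => ⟨x₁, ⟨hx.le, le_rfl⟩, _, mem_lin hy.le hs, by simp, by push_cast; ring⟩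
  obtain ⟨L₃, hL₃, hs₃, he₃, hi₃⟩ := key (x₁ + y₁ * Complex.I) (x₀ + y₁ * Complex.I)
    fun s hs => ⟨_, mem_lin' hx.le hs, y₁, ⟨hy.le, le_rfl⟩, by simp, by push_cast; ring⟩
  obtain ⟨L₄, hL₄, hs₄, he₄, hi₄⟩ := key (x₀ + y₁ * Complex.I) (x₀ + y₀ * Complex.I)
    fun s hs => ⟨x₀, ⟨le_rfl, hx.le⟩, _, mem_lin' hy.le hs, by simp, by push_cast; ring⟩
  have glue : ∀ {L M : ℝ × ℝ → ℂ} {z : ℂ}, Continuous L → Continuous M →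
      (∀ t ∈ Set.Icc (0 : ℝ) 1, Complex.exp (L (t, 1)) = (F.eval (C (t : ℂ))).eval z) →
      (∀ t ∈ Set.Icc (0 : ℝ) 1, Complex.exp (M (t, 0)) = (F.eval (C (t : ℂ))).eval z) →
      angleStep (L (0, 1)).im - angleStep (M (0, 0)).im =
        angleStep (L (1, 1)).im - angleStep (M (1, 0)).im := fun hL hM hLz hMz =>
    angleStep_sub_eq_of_exp_eq (L := fun t => _) (M := fun t => _) (by fun_prop) (by fun_prop)
      fun t ht => (hLz t ht).trans (hMz t ht).symm
  have g₁ := glue hL₁ hL₂ he₁ hs₂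
  have g₂ := glue hL₂ hL₃ he₂ hs₃
  have g₃ := glue hL₃ hL₄ he₃ hs₄
  have g₄ := glue hL₄ hL₁ he₄ hs₁
  have m₀ : (0 : ℝ) ∈ Set.Icc (0 : ℝ) 1 := by simp
  have m₁ : (1 : ℝ) ∈ Set.Icc (0 : ℝ) 1 := by simp
  rw [rectIndexC, rectIndexC, hi₁ 0 m₀, hi₂ 0 m₀, hi₃ 0 m₀, hi₄ 0 m₀, hi₁ 1 m₁, hi₂ 1 m₁,
    hi₃ 1 m₁, hi₄ 1 m₁]
  linarith
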